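/- Let Λ be an artin algebra and let U be a piling submodule of a direct sum X ⊕ Y of finite length Λ-modules. Then at least one of the two compositions of the inclusion U ⊆ X ⊕ Y with the canonical projections, U → X or U → Y, is a monomorphism whose image is a piling submodule (of X, respectively of Y). -/

import Mathlib

/-!
Setting: `k` is a commutative artinian ring and `Λ` an artin `k`-algebra
(an algebra over `k` which is finitely generated as a `k`-module).
All modules considered are `Λ`-modules of finite length (`IsFiniteLength Λ M`),
and `|M|` denotes the length of `M`, implemented as the height
`Order.height (⊤ : Submodule Λ M)` of the lattice of submodules
(for a submodule `N` of an ambient module, its length is `Order.height N`).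
-/

universe u v

open Submodule

section GRDefs

variable (Λ : Type u) [Ring Λ]

/-- A submodule `N` of an ambient module is indecomposable (as a module):
it is nonzero, and whenever it is the direct sum of two submodules, one of them is zero. -/
def IndecSub {Y : Type v} [AddCommGroup Y] [Module Λ Y] (N : Submodule Λ Y) : Prop :=
  N ≠ ⊥ ∧ ∀ A B : Submodule Λ Y, A ≤ N → B ≤ N → A ⊔ B = N → A ⊓ B = ⊥ → A = ⊥ ∨ B = ⊥

/-- A module is indecomposable iff its top submodule is. -/
def IndecMod (M : Type v) [AddCommGroup M] [Module Λ M] : Prop :=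
  IndecSub Λ (⊤ : Submodule Λ M)

/-- The length `|M|` of a module, as an extended natural number. -/
noncomputable def modLen (M : Type v) [AddCommGroup M] [Module Λ M] : ℕ∞ :=
  Order.height (⊤ : Submodule Λ M)

/-- The length `|N|` of a submodule of an ambient module, as a natural number. -/
noncomputable def subLen {Y : Type v} [AddCommGroup Y] [Module Λ Y] (N : Submodule Λ Y) : ℕ :=
  (Order.height N).toNat

open Classical in
/-- Fuel-based auxiliary function for the Gabriel-Roiter measure. -/
noncomputable def muAux {Y : Type v} [AddCommGroup Y] [Module Λ Y] :
    ℕ → Submodule Λ Y → ℝ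
  | 0, _ => 0
  | n + 1, N =>
      (if IndecSub Λ N then (2 : ℝ) ^ (-(subLen Λ N : ℤ)) else 0)
        + sSup (muAux n '' {N' : Submodule Λ Y | N' < N})

/-- The Gabriel-Roiter measure `μ(N)` of a submodule `N` of an ambient module:
`μ(0) = 0`; if `N ≠ 0` is decomposable, `μ(N)` is the maximum of `μ(N')` over proper
submodules `N'` of `N`; if `N` is indecomposable, `μ(N) = 2^(-|N|)` plus this maximum.
(For modules of finite length the supremum is a maximum and the fuel `|N|` suffices for
the recursion, so this agrees with the usual inductive definition; the measure of a
submodule depends only on the sublattice of its submodules, hence it does not matter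
in which ambient module it is computed.) -/
noncomputable def mu {Y : Type v} [AddCommGroup Y] [Module Λ Y] (N : Submodule Λ Y) : ℝ :=
  muAux Λ (subLen Λ N) N

/-- The Gabriel-Roiter measure of a module. -/
noncomputable def muMod (M : Type v) [AddCommGroup M] [Module Λ M] : ℝ :=
  mu Λ (⊤ : Submodule Λ M)

/-- `X` is a Gabriel-Roiter submodule of the (indecomposable, non-simple) ambient
module `Y`: `X` is an indecomposable proper submodule with `μ(Y) = μ(X) + 2^(-|Y|)`. -/
def IsGRSub {Y : Type v} [AddCommGroup Y] [Module Λ Y] (X : Submodule Λ Y) : Prop :=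
  IndecMod Λ Y ∧ IndecSub Λ X ∧ X ≠ ⊤ ∧
    mu Λ (⊤ : Submodule Λ Y) = mu Λ X + (2 : ℝ) ^ (-(subLen Λ (⊤ : Submodule Λ Y) : ℤ))

/-- A map `u : X → Y` is a Gabriel-Roiter inclusion iff it is injective and its
image is a Gabriel-Roiter submodule of `Y`. -/
def IsGRInclusion {X Y : Type v} [AddCommGroup X] [Module Λ X] [AddCommGroup Y] [Module Λ Y]
    (u : X →ₗ[Λ] Y) : Prop :=
  Function.Injective u ∧ IsGRSub Λ (LinearMap.range u)

/-- A linear map is a split monomorphism. -/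
def IsSplitMonoHom {A B : Type v} [AddCommGroup A] [Module Λ A] [AddCommGroup B] [Module Λ B]
    (f : A →ₗ[Λ] B) : Prop :=
  ∃ g : B →ₗ[Λ] A, g.comp f = LinearMap.id

/-- A linear map is a split epimorphism. -/
def IsSplitEpiHom {A B : Type v} [AddCommGroup A] [Module Λ A] [AddCommGroup B] [Module Λ B]
    (f : A →ₗ[Λ] B) : Prop :=
  ∃ g : B →ₗ[Λ] A, f.comp g = LinearMap.id

/-- A morphism `f` in the category of finite length `Λ`-modules is irreducible if it is
neither a split monomorphism nor a split epimorphism and, whenever `f = g ∘ h` with the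
intermediate module of finite length, either `h` is a split monomorphism or `g` is a
split epimorphism. -/
def IsIrreducibleHom {A B : Type v} [AddCommGroup A] [Module Λ A] [AddCommGroup B] [Module Λ B]
    (f : A →ₗ[Λ] B) : Prop :=
  ¬ IsSplitMonoHom Λ f ∧ ¬ IsSplitEpiHom Λ f ∧
    ∀ (Z : Type v) [AddCommGroup Z] [Module Λ Z], IsFiniteLength Λ Z →
      ∀ (h : A →ₗ[Λ] Z) (g : Z →ₗ[Λ] B), f = g.comp h →
        IsSplitMonoHom Λ h ∨ IsSplitEpiHom Λ g

/-- An indecomposable submodule `U` of the ambient module is piling provided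
`μ(V) ≤ μ(U)` for every indecomposable submodule `V` with `|V| ≤ |U|`. -/
def IsPilingSub {Y : Type v} [AddCommGroup Y] [Module Λ Y] (U : Submodule Λ Y) : Prop :=
  IndecSub Λ U ∧ ∀ V : Submodule Λ Y, IndecSub Λ V →
    Order.height V ≤ Order.height U → mu Λ V ≤ mu Λ U

/-- A Gabriel-Roiter filtration `c 0 ⊂ c 1 ⊂ ⋯ ⊂ c t = N` of an (indecomposable)
submodule `N`: a chain of indecomposable submodules starting at a simple module such
that each inclusion `c i ⊂ c (i+1)` is a Gabriel-Roiter inclusion,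
i.e. `μ(c (i+1)) = μ(c i) + 2^(-|c (i+1)|)`. -/
def IsGRFiltration {Y : Type v} [AddCommGroup Y] [Module Λ Y] {t : ℕ}
    (c : Fin (t + 1) → Submodule Λ Y) (N : Submodule Λ Y) : Prop :=
  c (Fin.last t) = N ∧
  IsSimpleModule Λ (c 0) ∧
  (∀ i : Fin (t + 1), IndecSub Λ (c i)) ∧
  ∀ i : Fin t, c i.castSucc < c i.succ ∧
    mu Λ (c i.succ) = mu Λ (c i.castSucc) + (2 : ℝ) ^ (-(subLen Λ (c i.succ) : ℤ))

/-- A brick: a nonzero module all of whose nonzero endomorphisms are invertible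
(i.e. the endomorphism ring is a division ring). -/
def IsBrick (M : Type v) [AddCommGroup M] [Module Λ M] : Prop :=
  (∃ x : M, x ≠ 0) ∧ ∀ f : M →ₗ[Λ] M, f ≠ 0 → Function.Bijective f

/-- An `M`-filtration `0 = c 0 ⊂ c 1 ⊂ ⋯ ⊂ c m = Y` of the module `Y`
(so `c j` is the module `M[j]`, with `M[0] = 0`, and the `M`-length of `Y` is `m`):
all consecutive factors `c (i+1) / c i` are isomorphic to `M`. -/
structure IsMFiltration (M : Type v) [AddCommGroup M] [Module Λ M]
    {Y : Type v} [AddCommGroup Y] [Module Λ Y] {m : ℕ}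
    (c : Fin (m + 1) → Submodule Λ Y) : Prop where
  bot : c 0 = ⊥
  top : c (Fin.last m) = ⊤
  lt : ∀ i : Fin m, c i.castSucc < c i.succ
  quot : ∀ i : Fin m,
    Nonempty ((↥(c i.succ) ⧸ comap (c i.succ).subtype (c i.castSucc)) ≃ₗ[Λ] M)

/-- A homogeneous `M`-filtration: an `M`-filtration in which moreover all the
`M[i] = c i` with `i ≥ 1` are indecomposable and all the inclusions
`M[i-1] ⊂ M[i]` for `2 ≤ i ≤ m` are irreducible monomorphisms. -/
structure IsHomogMFiltration (M : Type v) [AddCommGroup M] [Module Λ M]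
    {Y : Type v} [AddCommGroup Y] [Module Λ Y] {m : ℕ}
    (c : Fin (m + 1) → Submodule Λ Y) extends IsMFiltration Λ M c : Prop where
  indec : ∀ i : Fin (m + 1), i ≠ 0 → IndecSub Λ (c i)
  irr : ∀ i : Fin m, (i : ℕ) ≠ 0 →
    IsIrreducibleHom Λ (Submodule.inclusion (toIsMFiltration.lt i).le)

end GRDefs

lemma toNat_lt_toNat_iff {a b : ℕ∞} (ha : a ≠ ⊤) (hb : b ≠ ⊤) : a.toNat < b.toNat ↔ a < b := by
  lift a to ℕ using ha
  lift b to ℕ using hb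
  simp

section MapRestriction

variable {Λ : Type u} [Ring Λ] {Y Z : Type v} [AddCommGroup Y] [Module Λ Y]
  [AddCommGroup Z] [Module Λ Z]

lemma inf_comap_map_of_inf_ker_eq_bot {f : Z →ₗ[Λ] Y} {U A : Submodule Λ Z}
    (hU : U ⊓ LinearMap.ker f = ⊥) (hA : A ≤ U) : U ⊓ (A.map f).comap f = A := by
  rw [Submodule.comap_map_eq, inf_comm, sup_inf_assoc_of_le _ hA, inf_comm, hU, sup_bot_eq]

lemma map_inf_comap_of_le_map {f : Z →ₗ[Λ] Y} {U : Submodule Λ Z} {B : Submodule Λ Y}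
    (hB : B ≤ U.map f) : (U ⊓ B.comap f).map f = B := by
  rw [← Submodule.map_inf_eq_map_inf_comap, inf_eq_right.2 hB]

lemma injective_submoduleMap_iff {f : Z →ₗ[Λ] Y} {U : Submodule Λ Z} :
    Function.Injective (f.submoduleMap U) ↔ U ⊓ LinearMap.ker f = ⊥ := by
  rw [injective_iff_map_eq_zero, Submodule.eq_bot_iff]
  constructor
  · rintro h x ⟨hx, hf⟩
    exact congrArg Subtype.val (h ⟨x, hx⟩ (Subtype.ext hf))
  · rintro h ⟨x, hx⟩ hf
    exact Subtype.ext (h x ⟨hx, congrArg Subtype.val hf⟩)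

lemma height_map_of_inf_ker_eq_bot {f : Z →ₗ[Λ] Y} {U : Submodule Λ Z}
    (hU : U ⊓ LinearMap.ker f = ⊥) : Order.height (U.map f) = Order.height U := by
  rw [← Module.length_submodule, ← Module.length_submodule]
  exact (LinearEquiv.ofBijective (f.submoduleMap U)
    ⟨injective_submoduleMap_iff.2 hU, f.submoduleMap_surjective U⟩).length_eq.symm

lemma subLen_map_of_inf_ker_eq_bot {f : Z →ₗ[Λ] Y} {U : Submodule Λ Z}
    (hU : U ⊓ LinearMap.ker f = ⊥) : subLen Λ (U.map f) = subLen Λ U := by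
  rw [subLen, subLen, height_map_of_inf_ker_eq_bot hU]

lemma indecSub_map_iff {f : Z →ₗ[Λ] Y} {U : Submodule Λ Z}
    (hU : U ⊓ LinearMap.ker f = ⊥) : IndecSub Λ (U.map f) ↔ IndecSub Λ U := by
  have hbot : ∀ A ≤ U, A.map f = ⊥ → A = ⊥ := fun A hA h => by
    rw [← hU, ← inf_comap_map_of_inf_ker_eq_bot hU hA, h, Submodule.comap_bot]
  constructor
  · rintro ⟨h0, h⟩
    refine ⟨fun hb => h0 (by rw [hb, Submodule.map_bot]), fun A B hA hB hs hi => ?_⟩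
    refine (h _ _ (Submodule.map_mono hA) (Submodule.map_mono hB)
      (by rw [← Submodule.map_sup, hs]) ?_).imp (hbot A hA) (hbot B hB)
    rw [← map_inf_comap_of_le_map (inf_le_left.trans (Submodule.map_mono hA)),
      Submodule.comap_inf, inf_inf_distrib_left, inf_comap_map_of_inf_ker_eq_bot hU hA,
      inf_comap_map_of_inf_ker_eq_bot hU hB, hi, Submodule.map_bot]
  · rintro ⟨h0, h⟩
    refine ⟨fun hb => h0 (hbot U le_rfl hb), fun A B hA hB hs hi => ?_⟩
    have hA' := map_inf_comap_of_le_map hA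
    have hB' := map_inf_comap_of_le_map hB
    have key := h (U ⊓ A.comap f) (U ⊓ B.comap f) inf_le_left inf_le_left ?_ ?_
    · exact key.imp (fun h => by rw [← hA', h, Submodule.map_bot])
        (fun h => by rw [← hB', h, Submodule.map_bot])
    · rw [← inf_comap_map_of_inf_ker_eq_bot hU (sup_le inf_le_left inf_le_left),
        Submodule.map_sup, hA', hB', hs, inf_comap_map_of_inf_ker_eq_bot hU le_rfl]
    · rw [← inf_inf_distrib_left, ← Submodule.comap_inf, hi, Submodule.comap_bot, hU]

lemma muAux_map_of_inf_ker_eq_bot {f : Z →ₗ[Λ] Y} (n : ℕ) {U : Submodule Λ Z}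
    (hU : U ⊓ LinearMap.ker f = ⊥) : muAux Λ n (U.map f) = muAux Λ n U := by
  induction n generalizing U with
  | zero => rfl
  | succ n ih =>
    have ih' : ∀ W ≤ U, muAux Λ n (W.map f) = muAux Λ n W := fun W hW =>
      ih (le_bot_iff.1 ((inf_le_inf_right _ hW).trans hU.le))
    have himg : muAux Λ n '' {N' | N' < U.map f} = muAux Λ n '' {N' | N' < U} := by
      ext r
      constructor
      · rintro ⟨N, hN, rfl⟩
        have hN' := map_inf_comap_of_le_map (le_of_lt hN)
        refine ⟨U ⊓ N.comap f, Set.mem_ofPred.2 (lt_of_le_of_ne inf_le_left fun h => ?_), ?_⟩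
        · rw [h] at hN'
          exact (ne_of_lt (Set.mem_ofPred.1 hN)) hN'.symm
        · rw [← ih' _ inf_le_left, hN']
      · rintro ⟨W, hW, rfl⟩
        refine ⟨W.map f, Set.mem_ofPred.2
          (lt_of_le_of_ne (Submodule.map_mono (le_of_lt hW)) fun h => ?_), ih' W (le_of_lt hW)⟩
        apply ne_of_lt (Set.mem_ofPred.1 hW)
        rw [← inf_comap_map_of_inf_ker_eq_bot hU (le_of_lt hW), h,
          inf_comap_map_of_inf_ker_eq_bot hU le_rfl]
    rw [muAux, muAux, himg, subLen_map_of_inf_ker_eq_bot hU]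
    congr 1
    by_cases h : IndecSub Λ U
    · rw [if_pos h, if_pos ((indecSub_map_iff hU).2 h)]
    · rw [if_neg h, if_neg (mt (indecSub_map_iff hU).1 h)]

lemma mu_map_of_inf_ker_eq_bot {f : Z →ₗ[Λ] Y} {U : Submodule Λ Z}
    (hU : U ⊓ LinearMap.ker f = ⊥) : mu Λ (U.map f) = mu Λ U := by
  rw [mu, mu, subLen_map_of_inf_ker_eq_bot hU, muAux_map_of_inf_ker_eq_bot _ hU]

lemma subLen_map_lt [IsArtinian Λ Z] [IsNoetherian Λ Z] {f : Z →ₗ[Λ] Y} {U : Submodule Λ Z}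
    (hU : U ⊓ LinearMap.ker f ≠ ⊥) : subLen Λ (U.map f) < subLen Λ U := by
  have hsum := Module.length_eq_add_of_exact (LinearMap.ker (f.submoduleMap U)).subtype
    (f.submoduleMap U) (Submodule.subtype_injective _) (f.submoduleMap_surjective U)
    (LinearMap.exact_subtype_ker_map _)
  rw [Module.length_submodule (N := U), Module.length_submodule (N := U.map f)] at hsum
  have hpos : 0 < Module.length Λ (LinearMap.ker (f.submoduleMap U)) := by
    rw [Module.length_pos_iff, Submodule.nontrivial_iff_ne_bot, ne_eq, LinearMap.ker_eq_bot]
    exact fun h => hU (injective_submoduleMap_iff.1 h)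
  have hfin := (Submodule.height_lt_top U).ne
  have hfin' : Order.height (U.map f) ≠ ⊤ := fun h => hfin (by rw [hsum, h, add_top])
  rw [subLen, subLen, toNat_lt_toNat_iff hfin' hfin]
  calc Order.height (U.map f) = 0 + Order.height (U.map f) := (zero_add _).symm
    _ < Module.length Λ (LinearMap.ker (f.submoduleMap U)) + Order.height (U.map f) :=
      (ENat.add_lt_add_iff_right hfin').2 hpos
    _ = Order.height U := hsum.symm

/-- Direct complements can be pulled back along a map which is injective on the summand. -/
lemma exists_complement_of_map {f : Z →ₗ[Λ] Y} {U M : Submodule Λ Z} (hUM : U ≤ M)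
    (hU : U ⊓ LinearMap.ker f = ⊥)
    (h : ∃ C ≤ M.map f, U.map f ⊔ C = M.map f ∧ U.map f ⊓ C = ⊥) :
    ∃ C ≤ M, U ⊔ C = M ∧ U ⊓ C = ⊥ := by
  obtain ⟨C, -, hs, hi⟩ := h
  refine ⟨M ⊓ C.comap f, inf_le_left, le_antisymm (sup_le hUM inf_le_left) fun x hx => ?_, ?_⟩
  · have hfx : f x ∈ U.map f ⊔ C := hs ▸ Submodule.mem_map_of_mem hx
    obtain ⟨_, ⟨u, hu, rfl⟩, c, hc, huc⟩ := Submodule.mem_sup.1 hfx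
    refine Submodule.mem_sup.2 ⟨u, hu, x - u, ⟨M.sub_mem hx (hUM hu), ?_⟩, by abel⟩
    rw [SetLike.mem_coe, Submodule.mem_comap, map_sub, ← huc, add_sub_cancel_left]
    exact hc
  · rw [Submodule.eq_bot_iff]
    rintro x ⟨hx, -, hxC⟩
    have : f x ∈ U.map f ⊓ C := ⟨Submodule.mem_map_of_mem hx, hxC⟩
    rw [hi] at this
    exact (Submodule.eq_bot_iff _).1 hU x ⟨hx, this⟩

end MapRestriction

section Measure

variable {Λ : Type u} [Ring Λ] {Y Z : Type v} [AddCommGroup Y] [Module Λ Y]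
  [AddCommGroup Z] [Module Λ Z]

lemma mu_bot : mu Λ (⊥ : Submodule Λ Z) = 0 := by
  simp [mu, subLen, muAux]

lemma exists_decomposition_of_not_indecSub {N : Submodule Λ Z} (hN : N ≠ ⊥)
    (h : ¬ IndecSub Λ N) :
    ∃ A B : Submodule Λ Z, A < N ∧ B < N ∧ A ⊔ B = N ∧ A ⊓ B = ⊥ := by
  simp only [IndecSub, not_and, not_forall, not_or] at h
  obtain ⟨A, B, hA, hB, hs, hi, hA0, hB0⟩ := h hN
  refine ⟨A, B, lt_of_le_of_ne hA ?_, lt_of_le_of_ne hB ?_, hs, hi⟩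
  · rintro rfl
    exact hB0 (by rwa [inf_eq_right.2 hB] at hi)
  · rintro rfl
    exact hA0 (by rwa [inf_eq_left.2 hA] at hi)

lemma not_exists_complement_of_indecSub {U' U : Submodule Λ Z} (hU : IndecSub Λ U)
    (h0 : U' ≠ ⊥) (hlt : U' < U) :
    ¬ ∃ C ≤ U, U' ⊔ C = U ∧ U' ⊓ C = ⊥ := by
  rintro ⟨C, hC, hs, hi⟩
  rcases hU.2 U' C hlt.le hC hs hi with h | rfl
  · exact h0 h
  · exact hlt.ne (by rwa [sup_bot_eq] at hs)

variable [IsArtinian Λ Z] [IsNoetherian Λ Z]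

lemma subLen_strictMono : StrictMono (subLen Λ : Submodule Λ Z → ℕ) := fun A B h =>
  (toNat_lt_toNat_iff A.height_lt_top.ne B.height_lt_top.ne).2 (Submodule.height_strictMono h)

lemma muAux_succ_eq (n : ℕ) (N : Submodule Λ Z) (hN : subLen Λ N ≤ n) :
    muAux Λ (n + 1) N = muAux Λ n N := by
  induction n generalizing N with
  | zero =>
    have hlt : {N' : Submodule Λ Z | N' < N} = ∅ := by
      ext N'
      simpa using fun h : N' < N => absurd (subLen_strictMono h) (by omega)
    have hind : ¬ IndecSub Λ N := fun h => by
      have := subLen_strictMono (bot_lt_iff_ne_bot.2 h.1)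
      omega
    simp [muAux, hlt, hind]
  | succ n ih =>
    have himg : muAux Λ (n + 1) '' {N' | N' < N} = muAux Λ n '' {N' | N' < N} :=
      Set.image_congr fun N' hN' => ih N' (by have := subLen_strictMono hN'; omega)
    rw [muAux, himg, muAux]

lemma muAux_eq_mu {n : ℕ} {N : Submodule Λ Z} (hN : subLen Λ N ≤ n) : muAux Λ n N = mu Λ N := by
  induction n, hN using Nat.le_induction with
  | base => rfl
  | succ n hn ih => rw [muAux_succ_eq n N hn, ih]

open Classical in
lemma mu_eq (N : Submodule Λ Z) : mu Λ N =
    (if IndecSub Λ N then (2 : ℝ) ^ (-(subLen Λ N : ℤ)) else 0)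
      + sSup (mu Λ '' {N' : Submodule Λ Z | N' < N}) := by
  have himg : muAux Λ (subLen Λ N) '' {N' | N' < N} = mu Λ '' {N' | N' < N} :=
    Set.image_congr fun N' hN' => muAux_eq_mu (subLen_strictMono hN').le
  rw [← muAux_eq_mu (Nat.le_succ _), muAux, himg]

lemma exists_mu_eq_div (n : ℕ) (N : Submodule Λ Z) (hN : subLen Λ N ≤ n) :
    ∃ k : ℕ, k < 2 ^ n ∧ mu Λ N = k / 2 ^ n := by
  induction n generalizing N with
  | zero =>
    rcases eq_or_ne N ⊥ with rfl | h
    · exact ⟨0, by simp, by simp [mu_bot]⟩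
    · have := subLen_strictMono (bot_lt_iff_ne_bot.2 h)
      omega
  | succ n ih =>
    rcases hN.lt_or_eq with hlt | heq
    · obtain ⟨k, hk, h⟩ := ih N (by omega)
      refine ⟨2 * k, by rw [pow_succ]; omega, ?_⟩
      rw [h]
      push_cast
      rw [pow_succ]
      field_simp
    · have hne : N ≠ ⊥ := by
        rintro rfl
        simp [subLen] at heq
      set S := mu Λ '' {N' : Submodule Λ Z | N' < N} with hS
      have hsub : S ⊆ (fun k : ℕ => (k : ℝ) / 2 ^ n) '' Set.Iio (2 ^ n) := by
        rintro _ ⟨N', hN', rfl⟩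
        obtain ⟨k, hk, h⟩ := ih N' (by have := subLen_strictMono hN'; omega)
        exact ⟨k, hk, h.symm⟩
      have hmem : sSup S ∈ S := Set.Nonempty.csSup_mem
        ⟨_, ⊥, bot_lt_iff_ne_bot.2 hne, rfl⟩ (((Set.finite_Iio _).image _).subset hsub)
      obtain ⟨k, hk, h⟩ := hsub hmem
      rw [mu_eq, ← hS, ← h, heq]
      rw [Set.mem_Iio] at hk
      split_ifs
      · refine ⟨2 * k + 1, by rw [pow_succ]; omega, ?_⟩
        rw [zpow_neg, zpow_natCast]
        push_cast
        rw [pow_succ]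
        field_simp
        ring
      · refine ⟨2 * k, by rw [pow_succ]; omega, ?_⟩
        push_cast
        rw [pow_succ]
        field_simp
        ring

lemma mu_nonneg (N : Submodule Λ Z) : 0 ≤ mu Λ N := by
  obtain ⟨k, -, h⟩ := exists_mu_eq_div _ N le_rfl
  rw [h]
  positivity

lemma finite_mu_image (N : Submodule Λ Z) : (mu Λ '' {N' : Submodule Λ Z | N' < N}).Finite := by
  refine ((Set.finite_Iio (2 ^ subLen Λ N)).image
    (fun k : ℕ => (k : ℝ) / 2 ^ subLen Λ N)).subset ?_
  rintro _ ⟨N', hN', rfl⟩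
  obtain ⟨k, hk, h⟩ := exists_mu_eq_div _ N' (subLen_strictMono hN').le
  exact ⟨k, hk, h.symm⟩

lemma exists_lt_mu_eq_sSup {N : Submodule Λ Z} (hN : N ≠ ⊥) :
    ∃ N' < N, mu Λ N' = sSup (mu Λ '' {N' : Submodule Λ Z | N' < N}) := by
  have hne : (mu Λ '' {N' : Submodule Λ Z | N' < N}).Nonempty :=
    ⟨_, ⊥, bot_lt_iff_ne_bot.2 hN, rfl⟩
  obtain ⟨A, hA, h⟩ := hne.csSup_mem (finite_mu_image N)
  exact ⟨A, hA, h⟩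

lemma mu_le_sSup_of_lt {A N : Submodule Λ Z} (h : A < N) :
    mu Λ A ≤ sSup (mu Λ '' {N' : Submodule Λ Z | N' < N}) :=
  le_csSup (finite_mu_image N).bddAbove ⟨A, h, rfl⟩

lemma mu_mono : Monotone (mu Λ : Submodule Λ Z → ℝ) := by
  intro A N h
  rcases h.eq_or_lt with rfl | h
  · rfl
  · rw [mu_eq N]
    have := mu_le_sSup_of_lt h
    split_ifs
    · have : (0 : ℝ) < 2 ^ (-(subLen Λ N : ℤ)) := by positivity
      linarith
    · linarith

lemma mu_lt_of_lt_of_indecSub {A N : Submodule Λ Z} (hN : IndecSub Λ N) (h : A < N) :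
    mu Λ A < mu Λ N := by
  rw [mu_eq N, if_pos hN]
  have := mu_le_sSup_of_lt h
  have : (0 : ℝ) < 2 ^ (-(subLen Λ N : ℤ)) := by positivity
  linarith

lemma mu_pos {N : Submodule Λ Z} (hN : N ≠ ⊥) : 0 < mu Λ N := by
  induction N using WellFoundedLT.induction with
  | ind N ih =>
    by_cases h : IndecSub Λ N
    · exact (mu_nonneg ⊥).trans_lt (mu_lt_of_lt_of_indecSub h (bot_lt_iff_ne_bot.2 hN))
    · obtain ⟨A, B, hA, hB, hs, -⟩ := exists_decomposition_of_not_indecSub hN h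
      by_cases hA0 : A = ⊥
      · rw [hA0, bot_sup_eq] at hs
        exact absurd hs hB.ne
      · exact (ih A hA hA0).trans_le (mu_mono hA.le)

lemma exists_indecSub_mu_eq {N : Submodule Λ Z} (hN : N ≠ ⊥) :
    ∃ V ≤ N, IndecSub Λ V ∧ mu Λ V = mu Λ N := by
  induction N using WellFoundedLT.induction with
  | ind N ih =>
    by_cases h : IndecSub Λ N
    · exact ⟨N, le_rfl, h, rfl⟩
    · obtain ⟨A, hA, hmu⟩ := exists_lt_mu_eq_sSup hN
      have hmuN : mu Λ N = mu Λ A := by rw [mu_eq N, if_neg h, hmu, zero_add]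
      have hA0 : A ≠ ⊥ := by
        rintro rfl
        exact (mu_pos hN).ne' (hmuN.trans mu_bot)
      obtain ⟨V, hV, hVi, hVmu⟩ := ih A hA hA0
      exact ⟨V, hV.trans hA.le, hVi, hVmu.trans hmuN.symm⟩

lemma mu_ne_of_subLen_lt [IsArtinian Λ Y] [IsNoetherian Λ Y] {V : Submodule Λ Y}
    {U : Submodule Λ Z} (hU : IndecSub Λ U) (h : subLen Λ V < subLen Λ U) :
    mu Λ V ≠ mu Λ U := by
  obtain ⟨n, hn⟩ := Nat.exists_eq_succ_of_ne_zero (Nat.ne_zero_of_lt h)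
  obtain ⟨U', hU', hmu⟩ := exists_lt_mu_eq_sSup hU.1
  have hlt := subLen_strictMono hU'
  obtain ⟨k, -, hk⟩ := exists_mu_eq_div n V (by omega)
  obtain ⟨j, -, hj⟩ := exists_mu_eq_div n U' (by omega)
  rw [mu_eq U, if_pos hU, ← hmu, hk, hj, hn, zpow_neg, zpow_natCast, pow_succ]
  intro heq
  field_simp at heq
  have heq' : k * 2 = 1 + 2 * j := by exact_mod_cast heq
  omega

/-- No module shorter than an indecomposable module `U` has its measure strictly between the
maximum of the measures of the proper submodules of `U` and the measure of `U`. -/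
lemma mu_eq_of_le_of_lt [IsArtinian Λ Y] [IsNoetherian Λ Y] {V : Submodule Λ Y}
    {U U' : Submodule Λ Z} (hU : IndecSub Λ U) (hU' : U' < U)
    (hmu : mu Λ U' = sSup (mu Λ '' {N' : Submodule Λ Z | N' < U}))
    (h : subLen Λ V < subLen Λ U) (hle : mu Λ U' ≤ mu Λ V) (hlt : mu Λ V < mu Λ U) :
    mu Λ U' = mu Λ V := by
  obtain ⟨n, hn⟩ := Nat.exists_eq_succ_of_ne_zero (Nat.ne_zero_of_lt h)
  have hlen := subLen_strictMono hU'
  obtain ⟨k, -, hk⟩ := exists_mu_eq_div n V (by omega)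
  obtain ⟨j, -, hj⟩ := exists_mu_eq_div n U' (by omega)
  rw [mu_eq U, if_pos hU, ← hmu, hk, hj, hn, zpow_neg, zpow_natCast, pow_succ] at hlt
  rw [hk, hj] at hle ⊢
  field_simp at hle hlt
  have hle' : j ≤ k := by exact_mod_cast hle
  have hlt' : k * 2 < 1 + j * 2 := by exact_mod_cast hlt
  rw [show j = k by omega]

end Measure

section MainProperty

variable {Λ : Type u} [Ring Λ]

/-- The Gabriel-Roiter inequality for submodules of length `n` which embed into a direct sum
of two modules, the embedding being given by its two components. -/
def MainInequality (Λ : Type u) [Ring Λ] (n : ℕ) : Prop :=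
  ∀ (Z X Y : Type v) [AddCommGroup Z] [Module Λ Z] [AddCommGroup X] [Module Λ X]
    [AddCommGroup Y] [Module Λ Y] [IsArtinian Λ Z] [IsNoetherian Λ Z]
    [IsArtinian Λ X] [IsNoetherian Λ X] [IsArtinian Λ Y] [IsNoetherian Λ Y]
    (f : Z →ₗ[Λ] X) (g : Z →ₗ[Λ] Y) (U : Submodule Λ Z), IndecSub Λ U → subLen Λ U = n →
    U ⊓ LinearMap.ker f ⊓ LinearMap.ker g = ⊥ →
    mu Λ U ≤ max (mu Λ (U.map f)) (mu Λ (U.map g))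

/-- An indecomposable submodule with maximal Gabriel-Roiter measure is a direct summand. -/
lemma exists_complement_of_mu_eq {n : ℕ} (H : MainInequality.{u, v} Λ n)
    {Z : Type v} [AddCommGroup Z] [Module Λ Z] [IsArtinian Λ Z] [IsNoetherian Λ Z]
    {U M : Submodule Λ Z} (hU : IndecSub Λ U) (hn : subLen Λ U = n) (hUM : U ≤ M)
    (hmu : mu Λ U = mu Λ M) : ∃ C ≤ M, U ⊔ C = M ∧ U ⊓ C = ⊥ := by
  induction hm : subLen Λ M using Nat.strong_induction_on generalizing Z with
  | _ m ih =>
    by_cases hM : IndecSub Λ M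
    · rcases hUM.eq_or_lt with rfl | hlt
      · exact ⟨⊥, bot_le, sup_bot_eq _, inf_bot_eq _⟩
      · exact absurd hmu (mu_lt_of_lt_of_indecSub hM hlt).ne
    have hM0 : M ≠ ⊥ := by
      rintro rfl
      exact hU.1 (le_bot_iff.1 hUM)
    obtain ⟨A, B, hA, hB, hs, hi⟩ := exists_decomposition_of_not_indecSub hM0 hM
    have step : ∀ A B : Submodule Λ Z, A < M → A ⊔ B = M → A ⊓ B = ⊥ →
        U ⊓ LinearMap.ker B.mkQ = ⊥ → ∃ C ≤ M, U ⊔ C = M ∧ U ⊓ C = ⊥ := by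
      intro A B hA hs hi hUB
      have hAB : A ⊓ LinearMap.ker B.mkQ = ⊥ := by rwa [Submodule.ker_mkQ]
      have hmap : M.map B.mkQ = A.map B.mkQ := by
        rw [← hs, Submodule.map_sup, Submodule.mkQ_map_self, sup_bot_eq]
      have hlen : subLen Λ (M.map B.mkQ) < m := by
        rw [hmap, subLen_map_of_inf_ker_eq_bot hAB, ← hm]
        exact subLen_strictMono hA
      refine exists_complement_of_map hUM hUB (ih _ hlen ((indecSub_map_iff hUB).2 hU)
        ((subLen_map_of_inf_ker_eq_bot hUB).trans hn) (Submodule.map_mono hUM) ?_ rfl)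
      refine le_antisymm (mu_mono (Submodule.map_mono hUM)) ?_
      rw [hmap, mu_map_of_inf_ker_eq_bot hAB, mu_map_of_inf_ker_eq_bot hUB, hmu]
      exact mu_mono hA.le
    by_cases hUB : U ⊓ LinearMap.ker B.mkQ = ⊥
    · exact step A B hA hs hi hUB
    by_cases hUA : U ⊓ LinearMap.ker A.mkQ = ⊥
    · exact step B A hB (sup_comm A B ▸ hs) (inf_comm A B ▸ hi) hUA
    have bound : ∀ A B : Submodule Λ Z, A ≤ M → A ⊔ B = M → A ⊓ B = ⊥ →
        U ⊓ LinearMap.ker B.mkQ ≠ ⊥ → mu Λ (U.map B.mkQ) < mu Λ U := by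
      intro A B hA hs hi hUB
      have hAB : A ⊓ LinearMap.ker B.mkQ = ⊥ := by rwa [Submodule.ker_mkQ]
      refine lt_of_le_of_ne ?_ (mu_ne_of_subLen_lt hU (subLen_map_lt hUB))
      calc mu Λ (U.map B.mkQ) ≤ mu Λ (M.map B.mkQ) := mu_mono (Submodule.map_mono hUM)
        _ = mu Λ A := by
          rw [← hs, Submodule.map_sup, Submodule.mkQ_map_self, sup_bot_eq,
            mu_map_of_inf_ker_eq_bot hAB]
        _ ≤ mu Λ M := mu_mono hA
        _ = mu Λ U := hmu.symm
    refine absurd (H _ _ _ B.mkQ A.mkQ U hU hn ?_) (not_le.2 (max_lt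
      (bound A B hA.le hs hi hUB) (bound B A hB.le (sup_comm A B ▸ hs) (inf_comm A B ▸ hi) hUA)))
    rw [Submodule.ker_mkQ, Submodule.ker_mkQ, inf_assoc, inf_comm B A, hi, inf_bot_eq]

lemma mainInequality (n : ℕ) : MainInequality.{u, v} Λ n := by
  induction n using Nat.strong_induction_on with
  | _ n ih =>
    intro Z X Y _ _ _ _ _ _ _ _ _ _ _ _ f g U hU hn hfg
    by_cases hf : U ⊓ LinearMap.ker f = ⊥
    · exact le_max_of_le_left (mu_map_of_inf_ker_eq_bot hf).ge
    by_cases hg : U ⊓ LinearMap.ker g = ⊥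
    · exact le_max_of_le_right (mu_map_of_inf_ker_eq_bot hg).ge
    by_contra! hlt
    obtain ⟨hltf, hltg⟩ := max_lt_iff.1 hlt
    obtain ⟨U₀, hU₀, hmu₀⟩ := exists_lt_mu_eq_sSup hU.1
    have h0 : U₀ ≠ ⊥ := by
      rintro rfl
      have := mu_le_sSup_of_lt (lt_of_le_of_ne (inf_le_left : U ⊓ LinearMap.ker f ≤ U) fun h => by
        rw [h] at hfg
        exact hg hfg)
      rw [← hmu₀, mu_bot] at this
      exact (mu_pos hf).not_ge this
    obtain ⟨U', hU'₀, hU'i, hmu'⟩ := exists_indecSub_mu_eq h0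
    have hU' : U' < U := hU'₀.trans_lt hU₀
    have hmu := hmu'.trans hmu₀
    have hsub : U' ⊓ LinearMap.ker f ⊓ LinearMap.ker g = ⊥ :=
      le_bot_iff.1 ((inf_le_inf_right _ (inf_le_inf_right _ hU'.le)).trans hfg.le)
    have H := ih _ (hn ▸ subLen_strictMono hU')
    have hmain := H Z X Y f g U' hU'i rfl hsub
    have eq_of_le : ∀ (W : Type v) [AddCommGroup W] [Module Λ W] [IsArtinian Λ W]
        [IsNoetherian Λ W] (e : Z →ₗ[Λ] W), U ⊓ LinearMap.ker e ≠ ⊥ →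
        mu Λ (U.map e) < mu Λ U → mu Λ U' ≤ mu Λ (U.map e) → mu Λ U' = mu Λ (U.map e) :=
      fun W _ _ _ _ e he hlt hle =>
        mu_eq_of_le_of_lt hU hU' hmu (subLen_map_lt he) hle hlt
    have strict : ∀ (W : Type v) [AddCommGroup W] [Module Λ W] [IsArtinian Λ W]
        [IsNoetherian Λ W] (e : Z →ₗ[Λ] W), U ⊓ LinearMap.ker e ≠ ⊥ →
        mu Λ (U.map e) < mu Λ U → mu Λ (U'.map e) < mu Λ U' := by
      intro W _ _ _ _ e he hlt
      have hmono : mu Λ (U'.map e) ≤ mu Λ (U.map e) := mu_mono (Submodule.map_mono hU'.le)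
      by_cases hinj : U' ⊓ LinearMap.ker e = ⊥
      · have heq := mu_map_of_inf_ker_eq_bot hinj
        refine absurd ?_ (not_exists_complement_of_indecSub hU hU'i.1 hU')
        refine exists_complement_of_map hU'.le hinj (exists_complement_of_mu_eq H
          ((indecSub_map_iff hinj).2 hU'i) (subLen_map_of_inf_ker_eq_bot hinj)
          (Submodule.map_mono hU'.le) ?_)
        rw [heq]
        exact eq_of_le W e he hlt (heq ▸ hmono)
      · refine lt_of_le_of_ne (not_lt.1 fun hgt => ?_)
          (mu_ne_of_subLen_lt hU'i (subLen_map_lt hinj))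
        have := eq_of_le W e he hlt (hgt.le.trans hmono)
        exact absurd hgt (not_lt.2 (this ▸ hmono))
    exact absurd hmain (not_le.2 (max_lt (strict X f hf hltf) (strict Y g hg hltg)))

/-- The image of a piling submodule `U` of `M` under a map which is injective on `U` is piling,
provided the target embeds into `M`. -/
lemma IsPilingSub.map {X M : Type v} [AddCommGroup X] [Module Λ X] [AddCommGroup M] [Module Λ M]
    {U : Submodule Λ M} (hU : IsPilingSub Λ U) (p : M →ₗ[Λ] X) (i : X →ₗ[Λ] M)
    (hp : U ⊓ LinearMap.ker p = ⊥) (hi : LinearMap.ker i = ⊥) : IsPilingSub Λ (U.map p) := by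
  refine ⟨(indecSub_map_iff hp).2 hU.1, fun V hV hle => ?_⟩
  have hVi : V ⊓ LinearMap.ker i = ⊥ := by rw [hi, inf_bot_eq]
  rw [mu_map_of_inf_ker_eq_bot hp, ← mu_map_of_inf_ker_eq_bot hVi]
  refine hU.2 _ ((indecSub_map_iff hVi).2 hV) ?_
  rwa [height_map_of_inf_ker_eq_bot hVi, ← height_map_of_inf_ker_eq_bot hp]

lemma IsPilingSub.mu_map_lt {X M : Type v} [AddCommGroup X] [Module Λ X]
    [AddCommGroup M] [Module Λ M] [IsArtinian Λ X] [IsNoetherian Λ X] [IsArtinian Λ M]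
    [IsNoetherian Λ M] {U : Submodule Λ M} (hU : IsPilingSub Λ U) (p : M →ₗ[Λ] X)
    (i : X →ₗ[Λ] M) (hp : U ⊓ LinearMap.ker p ≠ ⊥) (hi : LinearMap.ker i = ⊥) :
    mu Λ (U.map p) < mu Λ U := by
  have hlen := subLen_map_lt hp
  refine lt_of_le_of_ne ?_ (mu_ne_of_subLen_lt hU.1 hlen)
  rcases eq_or_ne (U.map p) ⊥ with h | h
  · rw [h, mu_bot]
    exact mu_nonneg U
  · obtain ⟨V, hV, hVi, hVmu⟩ := exists_indecSub_mu_eq h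
    have hker : V ⊓ LinearMap.ker i = ⊥ := by rw [hi, inf_bot_eq]
    rw [← hVmu, ← mu_map_of_inf_ker_eq_bot hker]
    refine hU.2 _ ((indecSub_map_iff hker).2 hVi) ?_
    rw [height_map_of_inf_ker_eq_bot hker]
    exact (Order.height_mono hV).trans ((toNat_lt_toNat_iff
      (Submodule.height_lt_top _).ne (Submodule.height_lt_top _).ne).1 hlen).le

lemma injective_comp_subtype {X M : Type v} [AddCommGroup X] [Module Λ X] [AddCommGroup M]
    [Module Λ M] {U : Submodule Λ M} {p : M →ₗ[Λ] X} (hp : U ⊓ LinearMap.ker p = ⊥) :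
    Function.Injective (p.comp U.subtype) := by
  rw [← LinearMap.ker_eq_bot, LinearMap.ker_comp, ← Submodule.disjoint_iff_comap_eq_bot,
    disjoint_iff, hp]

end MainProperty

/-- If `U` is a piling submodule of a direct sum `X ⊕ Y` (realized as
the product `X × Y`), then at least one of the compositions of the inclusion with the
canonical projections `U → X`, `U → Y` is a monomorphism whose image is a piling
submodule of `X`, respectively of `Y`. -/
theorem gabriel_roiter_stmt11
    (k : Type u) [CommRing k] [IsArtinianRing k]
    (Λ : Type u) [Ring Λ] [Algebra k Λ] [Module.Finite k Λ]
    (X : Type v) [AddCommGroup X] [Module Λ X] (hXfl : IsFiniteLength Λ X)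
    (Y : Type v) [AddCommGroup Y] [Module Λ Y] (hYfl : IsFiniteLength Λ Y)
    (U : Submodule Λ (X × Y)) (hU : IsPilingSub Λ U) :
    (Function.Injective ((LinearMap.fst Λ X Y).comp U.subtype) ∧
      IsPilingSub Λ (U.map (LinearMap.fst Λ X Y))) ∨
    (Function.Injective ((LinearMap.snd Λ X Y).comp U.subtype) ∧
      IsPilingSub Λ (U.map (LinearMap.snd Λ X Y))) := by
  obtain ⟨_, _⟩ := isFiniteLength_iff_isNoetherian_isArtinian.1 hXfl
  obtain ⟨_, _⟩ := isFiniteLength_iff_isNoetherian_isArtinian.1 hYfl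
  have hl : LinearMap.ker (LinearMap.inl Λ X Y) = ⊥ :=
    LinearMap.ker_eq_bot.2 LinearMap.inl_injective
  have hr : LinearMap.ker (LinearMap.inr Λ X Y) = ⊥ :=
    LinearMap.ker_eq_bot.2 LinearMap.inr_injective
  by_cases hf : U ⊓ LinearMap.ker (LinearMap.fst Λ X Y) = ⊥
  · exact Or.inl ⟨injective_comp_subtype hf, hU.map _ (LinearMap.inl Λ X Y) hf hl⟩
  by_cases hs : U ⊓ LinearMap.ker (LinearMap.snd Λ X Y) = ⊥
  · exact Or.inr ⟨injective_comp_subtype hs, hU.map _ (LinearMap.inr Λ X Y) hs hr⟩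
  have hker : U ⊓ LinearMap.ker (LinearMap.fst Λ X Y) ⊓ LinearMap.ker (LinearMap.snd Λ X Y) = ⊥ :=
    (Submodule.eq_bot_iff _).2 fun x hx => Prod.ext hx.1.2 hx.2
  have hmain : MainInequality.{u, v} Λ (subLen Λ U) := mainInequality _
  exact absurd (hmain _ _ _ _ _ U hU.1 rfl hker) (not_le.2 (max_lt
    (hU.mu_map_lt _ (LinearMap.inl Λ X Y) hf hl) (hU.mu_map_lt _ (LinearMap.inr Λ X Y) hs hr)))
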